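/- arXiv:2110.09580 — 2 statements merged into one kernel-verified Lean document; each statement's English description precedes it below -/
import Mathlib

section
/- Alternate characterization of the lossy ∞-Wasserstein distance: for any probability distributions P and Q on a metric space (Ω, d) and any γ ∈ [0,1], W∞^γ(P, Q) equals the infimum of W∞(P̂, Q̂) over all pairs of probability distributions P̂, Q̂ on Ω satisfying Δ(P, P̂) + Δ(Q, Q̂) ≤ γ. -/
open MeasureTheory ENNReal

noncomputable section

variable {Ω : Type*} [MeasurableSpace Ω]

/-- Total variation distance between two measures. -/
def tvDist (P Q : Measure Ω) : ℝ≥0∞ :=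
  ⨆ (s : Set Ω) (_ : MeasurableSet s), P s - Q s

/-- The `γ`-lossy `∞`-Wasserstein distance between `P` and `Q` with respect to the
cost function `d`. -/
def lossyWinf (d : Ω → Ω → ℝ≥0∞) (γ : ℝ≥0∞) (P Q : Measure Ω) : ℝ≥0∞ :=
  ⨅ (φ : Measure (Ω × Ω)) (_ : IsProbabilityMeasure φ)
    (_ : tvDist P (φ.map Prod.fst) + tvDist Q (φ.map Prod.snd) ≤ γ),
    essSup (fun p => d p.1 p.2) φ

theorem eq_of_tvDist_eq_zero {Ω : Type*} [MeasurableSpace Ω] {P Q : Measure Ω}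
    [IsProbabilityMeasure P] [IsProbabilityMeasure Q] (h : tvDist P Q = 0) : P = Q := by
  refine Measure.eq_of_le_of_isProbabilityMeasure (Measure.le_iff.2 fun s hs => ?_)
  simp only [tvDist, ENNReal.iSup_eq_zero] at h
  exact tsub_eq_zero_iff_le.1 (h s hs)

theorem tvDist_self {Ω : Type*} [MeasurableSpace Ω] (P : Measure Ω) : tvDist P P = 0 := by
  simp [tvDist]

/-- Alternate characterization of the lossy ∞-Wasserstein distance: it equals the infimum
of the (lossless) ∞-Wasserstein distance over nearby pairs of distributions. -/
theorem lossyWinf_eq_iInf_Winf {Ω : Type*} [EMetricSpace Ω] [MeasurableSpace Ω]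
    (P Q : Measure Ω) [IsProbabilityMeasure P] [IsProbabilityMeasure Q]
    (γ : ℝ≥0∞) (hγ : γ ≤ 1) :
    lossyWinf edist γ P Q =
      ⨅ (P' : Measure Ω) (Q' : Measure Ω) (_ : IsProbabilityMeasure P')
        (_ : IsProbabilityMeasure Q') (_ : tvDist P P' + tvDist Q Q' ≤ γ),
        lossyWinf edist 0 P' Q' := by
  have map_fst (φ : Measure (Ω × Ω)) [IsProbabilityMeasure φ] :
      IsProbabilityMeasure (φ.map Prod.fst) :=
    Measure.isProbabilityMeasure_map measurable_fst.aemeasurable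
  have map_snd (φ : Measure (Ω × Ω)) [IsProbabilityMeasure φ] :
      IsProbabilityMeasure (φ.map Prod.snd) :=
    Measure.isProbabilityMeasure_map measurable_snd.aemeasurable
  apply le_antisymm
  · refine le_iInf fun P' => le_iInf fun Q' => le_iInf fun _ => le_iInf fun _ =>
      le_iInf fun h => le_iInf fun φ => le_iInf fun hφ => le_iInf fun h0 => ?_
    obtain ⟨h1, h2⟩ := add_eq_zero.1 (le_zero_iff.1 h0)
    rw [eq_of_tvDist_eq_zero h1, eq_of_tvDist_eq_zero h2] at h
    exact iInf_le_of_le φ (iInf_le_of_le hφ (iInf_le _ h))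
  · refine le_iInf fun φ => le_iInf fun hφ => le_iInf fun h => ?_
    refine iInf_le_of_le (φ.map Prod.fst) (iInf_le_of_le (φ.map Prod.snd)
      (iInf_le_of_le (map_fst φ) (iInf_le_of_le (map_snd φ) (iInf_le_of_le h ?_))))
    exact iInf_le_of_le φ (iInf_le_of_le hφ (iInf_le _ (by simp [tvDist_self])))
end
end

section
/- Pre-processing theorem for differential privacy: let M₁: A → B and M₂: B → C be randomized mechanisms. If M₁ is neighborhood preserving with respect to neighborhood relations ∼_A on A and ∼_B on B, and M₂ is (ε, δ)-differentially private with respect to ∼_B, then the composed mechanism M₂∘M₁: A → C is (ε, δ)-differentially private with respect to ∼_A. -/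
open MeasureTheory ENNReal

noncomputable section

/-- Pre-processing theorem for differential privacy: if `M₁ : A → B` is neighborhood
preserving w.r.t. `∼_A` and `∼_B`, and `M₂ : B → C` is `(ε, δ)`-differentially private
w.r.t. `∼_B`, then `M₂ ∘ M₁` is `(ε, δ)`-differentially private w.r.t. `∼_A`. -/
theorem dp_preprocessing {A B C : Type*} [MeasurableSpace A] [MeasurableSpace B]
    [MeasurableSpace C]
    (relA : A → A → Prop) (relB : B → B → Prop)
    (hsymA : Symmetric relA) (hsymB : Symmetric relB)
    (M₁ : A → Measure B) (M₂ : B → Measure C)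
    (hM₁prob : ∀ a, IsProbabilityMeasure (M₁ a))
    (hM₂prob : ∀ b, IsProbabilityMeasure (M₂ b))
    (hM₂meas : Measurable M₂)
    -- `M₁` is neighborhood preserving w.r.t. `relA` and `relB`:
    (hNP : ∀ x y : A, relA x y →
      ∃ μ : Measure (B × B), IsProbabilityMeasure μ ∧
        μ.map Prod.fst = M₁ x ∧ μ.map Prod.snd = M₁ y ∧ μ {p : B × B | relB p.1 p.2} = 1)
    (ε : ℝ) (δ : ℝ≥0∞)
    -- `M₂` is `(ε, δ)`-differentially private w.r.t. `relB`:
    (hDP : ∀ b b' : B, relB b b' → ∀ S : Set C, MeasurableSet S →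
      M₂ b S ≤ ENNReal.ofReal (Real.exp ε) * M₂ b' S + δ) :
    -- then `M₂ ∘ M₁` is `(ε, δ)`-differentially private w.r.t. `relA`:
    ∀ x x' : A, relA x x' → ∀ S : Set C, MeasurableSet S →
      ((M₁ x).bind M₂) S ≤ ENNReal.ofReal (Real.exp ε) * ((M₁ x').bind M₂) S + δ := by
  intro x x' hxx' S hS
  obtain ⟨μ, hμ, hfst, hsnd, hrel⟩ := hNP x x' hxx'
  have hf : Measurable fun b => M₂ b S := (Measure.measurable_coe hS).comp hM₂meas
  have hf₁ : Measurable fun p : B × B => M₂ p.1 S := hf.comp measurable_fst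
  have hf₂ : Measurable fun p : B × B => M₂ p.2 S := hf.comp measurable_snd
  -- `relB` need not be measurable, but it is contained in this measurable set.
  have hmeas : MeasurableSet {p : B × B |
      M₂ p.1 S ≤ ENNReal.ofReal (Real.exp ε) * M₂ p.2 S + δ} :=
    measurableSet_le hf₁ ((hf₂.const_mul _).add_const δ)
  have hae : ∀ᵐ p ∂μ, M₂ p.1 S ≤ ENNReal.ofReal (Real.exp ε) * M₂ p.2 S + δ := by
    refine (mem_ae_iff_prob_eq_one hmeas).2 (le_antisymm prob_le_one ?_)
    exact hrel.ge.trans (measure_mono fun p hp => hDP p.1 p.2 hp S hS)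
  rw [Measure.bind_apply hS hM₂meas.aemeasurable, Measure.bind_apply hS hM₂meas.aemeasurable,
    ← hfst, ← hsnd, lintegral_map hf measurable_fst, lintegral_map hf measurable_snd]
  calc ∫⁻ p, M₂ p.1 S ∂μ
      ≤ ∫⁻ p, (ENNReal.ofReal (Real.exp ε) * M₂ p.2 S + δ) ∂μ := lintegral_mono_ae hae
    _ = ENNReal.ofReal (Real.exp ε) * ∫⁻ p, M₂ p.2 S ∂μ + δ := by
      rw [lintegral_add_left (hf₂.const_mul _), lintegral_const_mul _ hf₂,
        lintegral_const, measure_univ, mul_one]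
end
end
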